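/- arXiv:2205.15239 — 2 statements merged into one kernel-verified Lean document; each statement's English description precedes it below -/
import Mathlib

section
/- (Optimal projection.) Let 𝒴 = {y_1, …, y_K} with π(y_1) ≤ … ≤ π(y_K) = 1 and π_i = π(y_i); fix i, let Y_{π_i} = { y ∈ 𝒴 : π(y) ≤ π_i }, let Ȳ ⊆ Y_{π_i} be a set of classes with arbitrarily fixed probabilities p^r(y) ∈ [0,1] (y ∈ Ȳ) such that A := ∑_{y∈Ȳ} p^r(y) ≤ π_i and Y_{π_i}\Ȳ is nonempty, let p̂ ∈ ℙ(𝒴) be strictly positive, and let p^r ∈ half-space_{π_i} be the piecewise-proportional extension given by p^r(y) = (π_i − A)·p̂(y)/∑_{y'∈Y_{π_i}\Ȳ} p̂(y') for y ∈ Y_{π_i}\Ȳ and p^r(y) = (1 − π_i)·p̂(y)/∑_{y'∈𝒴\Y_{π_i}} p̂(y') for y ∈ 𝒴\Y_{π_i}. Then p^r is optimal in the sense that there is no p ∈ half-space_{π_i} with p(y) = p^r(y) for all y ∈ Ȳ such that D_KL(p‖p̂) < D_KL(p^r‖p̂); equivalently, every such p satisfies D_KL(p‖p̂) ≥ D_KL(p^r‖p̂).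 -/
open scoped Classical

/-- `p` is a probability distribution on `Fin (K+1)` (the class space `𝒴`). -/
def IsDist {K : ℕ} (p : Fin (K + 1) → ℝ) : Prop :=
  (∀ i, 0 ≤ p i) ∧ (∀ i, p i ≤ 1) ∧ ∑ i, p i = 1

/-- The level set `Y_c = { y ∈ 𝒴 : π(y) ≤ c }`. -/
noncomputable def Ylev {K : ℕ} (π : Fin (K + 1) → ℝ) (c : ℝ) : Finset (Fin (K + 1)) :=
  Finset.univ.filter (fun y => π y ≤ c)

/-- The piecewise-proportional extension `p^r` of fixed values `f` on `Ȳ`. -/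
noncomputable def projExt {K : ℕ} (π phat : Fin (K + 1) → ℝ) (i : Fin (K + 1))
    (Ybar : Finset (Fin (K + 1))) (f : Fin (K + 1) → ℝ) : Fin (K + 1) → ℝ := fun y =>
  if y ∈ Ybar then f y
  else if π y ≤ π i then
    (π i - ∑ z ∈ Ybar, f z) * phat y / ∑ z ∈ Ylev π (π i) \ Ybar, phat z
  else
    (1 - π i) * phat y / ∑ z ∈ Finset.univ \ Ylev π (π i), phat z

/-- Kullback–Leibler divergence `D_KL(p‖q) = ∑_y p(y) log(p(y)/q(y))`
(with the convention `0 · log 0 = 0`, which holds since `Real.log 0 = 0`). -/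
noncomputable def KL {K : ℕ} (p q : Fin (K + 1) → ℝ) : ℝ :=
  ∑ y, p y * Real.log (p y / q y)

/-- A tangent-line bound for `x ↦ x * log (x / q)` at `x = c * q`. -/
lemma mul_log_add_sub_le_mul_log_div {x q c : ℝ} (hx : 0 ≤ x) (hq : 0 < q) (hc : 0 < c) :
    x * Real.log c + (x - c * q) ≤ x * Real.log (x / q) := by
  rcases hx.eq_or_lt with rfl | hx
  · simpa using (mul_pos hc hq).le
  · have h := Real.log_le_sub_one_of_pos (div_pos (mul_pos hc hq) hx)
    have hlog : Real.log (c * q / x) = Real.log c - Real.log (x / q) := by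
      rw [Real.log_div (by positivity) hx.ne', Real.log_mul hc.ne' hq.ne',
        Real.log_div hx.ne' hq.ne']
      ring
    rw [hlog] at h
    have h' := mul_le_mul_of_nonneg_left h hx.le
    have hcancel : x * (c * q / x - 1) = c * q - x := by field_simp
    linarith

/-- The log-sum inequality: among nonnegative functions on `s` with a given total mass, the one
proportional to `q` minimizes the divergence to `q`. -/
lemma sum_proportional_mul_log_le {ι : Type*} (s : Finset ι) (p q : ι → ℝ) {S : ℝ}
    (hp : ∀ y ∈ s, 0 ≤ p y) (hq : ∀ y ∈ s, 0 < q y) (hS : ∑ y ∈ s, p y = S) :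
    ∑ y ∈ s, S * q y / (∑ z ∈ s, q z) * Real.log (S * q y / (∑ z ∈ s, q z) / q y) ≤
      ∑ y ∈ s, p y * Real.log (p y / q y) := by
  rcases s.eq_empty_or_nonempty with rfl | hs
  · simp
  have hQ : 0 < ∑ z ∈ s, q z := Finset.sum_pos hq hs
  set Q := ∑ z ∈ s, q z with hQdef
  rcases (hS ▸ Finset.sum_nonneg hp : 0 ≤ S).eq_or_lt with rfl | hSpos
  · have hzero := (Finset.sum_eq_zero_iff_of_nonneg hp).1 hS
    rw [Finset.sum_eq_zero fun y hy => by simp,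
      Finset.sum_eq_zero fun y hy => by simp [hzero y hy]]
  · have hc : 0 < S / Q := div_pos hSpos hQ
    have hleft : ∑ y ∈ s, S * q y / Q * Real.log (S * q y / Q / q y) = S * Real.log (S / Q) := by
      have hterm : ∀ y ∈ s, S * q y / Q * Real.log (S * q y / Q / q y) =
          q y * (S / Q * Real.log (S / Q)) := fun y hy => by
        have hy' := (hq y hy).ne'
        have hratio : S * q y / Q / q y = S / Q := by field_simp
        rw [hratio]
        ring
      rw [Finset.sum_congr rfl hterm, ← Finset.sum_mul, ← hQdef]
      field_simp
    have hbound := Finset.sum_le_sum fun y hy =>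
      mul_log_add_sub_le_mul_log_div (hp y hy) (hq y hy) hc
    rw [Finset.sum_add_distrib, Finset.sum_sub_distrib, ← Finset.sum_mul, ← Finset.mul_sum,
      hS, ← hQdef, div_mul_cancel₀ _ hQ.ne'] at hbound
    linarith

/-- **Optimal projection.** Among all probability distributions in the
half-space `{ p : ∑_{y ∈ Y_{π_i}} p(y) = π_i }` that agree with the fixed values `f` on
`Ȳ`, the piecewise-proportional extension `p^r` minimizes the KL divergence to `p̂`:
every such `p` satisfies `D_KL(p‖p̂) ≥ D_KL(p^r‖p̂)`. -/
theorem projExt_optimal {K : ℕ} (π phat : Fin (K + 1) → ℝ)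
    (hmono : Monotone π) (hπ0 : ∀ y, 0 ≤ π y) (hnorm : π (Fin.last K) = 1)
    (hphat : IsDist phat) (hpos : ∀ y, 0 < phat y)
    (i : Fin (K + 1))
    (Ybar : Finset (Fin (K + 1))) (hsub : Ybar ⊆ Ylev π (π i))
    (hne : (Ylev π (π i) \ Ybar).Nonempty)
    (f : Fin (K + 1) → ℝ)
    (hf0 : ∀ y ∈ Ybar, 0 ≤ f y) (hf1 : ∀ y ∈ Ybar, f y ≤ 1)
    (hA : ∑ y ∈ Ybar, f y ≤ π i) :
    ∀ p : Fin (K + 1) → ℝ, IsDist p →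
      (∑ y ∈ Ylev π (π i), p y = π i) →
      (∀ y ∈ Ybar, p y = f y) →
      KL (projExt π phat i Ybar f) phat ≤ KL p phat := by
  intro p hp hhalf hagree
  set Y := Ylev π (π i) with hY
  have hmem : ∀ y, y ∈ Y ↔ π y ≤ π i := fun y => by simp [hY, Ylev]
  have hsplit : ∀ g : Fin (K + 1) → ℝ, ∑ y, g y =
      ∑ y ∈ Finset.univ \ Y, g y + (∑ y ∈ Y \ Ybar, g y + ∑ y ∈ Ybar, g y) := fun g => by
    rw [Finset.sum_sdiff hsub, Finset.sum_sdiff (Finset.subset_univ Y)]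
  have hmid : ∑ y ∈ Y \ Ybar, p y = π i - ∑ y ∈ Ybar, f y := by
    rw [← hhalf, ← Finset.sum_sdiff hsub, Finset.sum_congr rfl hagree]
    ring
  have hout : ∑ y ∈ Finset.univ \ Y, p y = 1 - π i := by
    rw [← hhalf, ← hp.2.2, ← Finset.sum_sdiff (Finset.subset_univ Y)]
    ring
  unfold KL
  rw [hsplit, hsplit]
  refine add_le_add ?_ (add_le_add ?_ ?_)
  · refine le_of_eq_of_le (Finset.sum_congr rfl fun y hy => ?_)
      (sum_proportional_mul_log_le _ p phat (fun y _ => hp.1 y) (fun y _ => hpos y) hout)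
    have hyY : y ∉ Y := (Finset.mem_sdiff.1 hy).2
    have hyval : projExt π phat i Ybar f y =
        (1 - π i) * phat y / ∑ z ∈ Finset.univ \ Y, phat z := by
      rw [projExt, if_neg fun h => hyY (hsub h), if_neg fun h => hyY ((hmem y).2 h)]
    rw [hyval]
  · refine le_of_eq_of_le (Finset.sum_congr rfl fun y hy => ?_)
      (sum_proportional_mul_log_le _ p phat (fun y _ => hp.1 y) (fun y _ => hpos y) hmid)
    obtain ⟨hyY, hyYbar⟩ := Finset.mem_sdiff.1 hy
    have hyval : projExt π phat i Ybar f y =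
        (π i - ∑ z ∈ Ybar, f z) * phat y / ∑ z ∈ Y \ Ybar, phat z := by
      rw [projExt, if_neg hyYbar, if_pos ((hmem y).1 hyY)]
    rw [hyval]
  · refine (Finset.sum_congr rfl fun y hy => ?_).le
    rw [projExt, if_pos hy, hagree y hy]
end

section
/- (Optimality of the greedy projection; Theorem 1.) Let 𝒴 = {y_1, …, y_K} with π(y_1) ≤ … ≤ π(y_K) = 1 and π_i = π(y_i), and let p̂ ∈ ℙ(𝒴) be strictly positive. Define p^r ∈ ℙ(𝒴) by the following recursion: if p̂ ∈ Q_π set p^r = p̂; otherwise, starting with the set of unassigned classes Y = 𝒴, repeat until Y is empty: choose y* ∈ Y with the highest possibility π(y*) such that assigning, for all y ∈ Y' := { y ∈ Y : π(y) ≤ π(y*) }, the value p^r(y) = ( π(y*) − ∑_{y'∉Y} p^r(y') ) · p̂(y)/∑_{y'∈Y'} p̂(y') violates none of the partial-sum constraints ∑_{k=1}^{j} p^r(y_k) ≤ π_j (for all indices j whose classes have been assigned so far), fix these values, and remove Y' from Y. Then the resulting p^r belongs to Q_π and satisfies D_KL(p^r‖p̂) = min_{p ∈ Q_π} D_KL(p‖p̂);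 in particular, the value returned by this procedure equals the optimistic superset loss L*(Q_π, p̂) = min_{p ∈ Q_π} D_KL(p‖p̂). -/
open scoped Classical

/-- `p` satisfies the credal-set constraints of `Q_π` (equivalent formulation for a
possibility distribution ordered increasingly along the index order):
`∑_{k=1}^{i} p(y_k) ≤ π_i` for all `i`. -/
def InCredalIic {K : ℕ} (π p : Fin (K + 1) → ℝ) : Prop :=
  ∀ i : Fin (K + 1), ∑ k ∈ Finset.Iic i, p k ≤ π i

/-- One assignment step of Algorithm 1: given the set `Y` of still-unassigned classes,
the values `f` fixed so far (on `𝒴 \ Y`), and a chosen class `y*`, assign to every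
`y ∈ Y' = { y ∈ Y : π(y) ≤ π(y*) }` the value
`(π(y*) − ∑_{y'∉Y} f(y')) · p̂(y) / ∑_{y'∈Y'} p̂(y')`, keeping all other values. -/
noncomputable def Assign {K : ℕ} (π phat : Fin (K + 1) → ℝ) (Y : Finset (Fin (K + 1)))
    (f : Fin (K + 1) → ℝ) (ystar : Fin (K + 1)) : Fin (K + 1) → ℝ := fun y =>
  if y ∈ Y ∧ π y ≤ π ystar then
    (π ystar - ∑ z ∈ Finset.univ \ Y, f z) * phat y /
      ∑ z ∈ Y.filter (fun z => π z ≤ π ystar), phat z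
  else f y

/-- The partial-sum constraints `∑_{k=1}^{j} g(y_k) ≤ π_j` hold for all indices `j`
whose classes have been assigned so far (i.e. `j ∉ Y`, the unassigned set). -/
def PartialOK {K : ℕ} (π g : Fin (K + 1) → ℝ) (Y : Finset (Fin (K + 1))) : Prop :=
  ∀ j : Fin (K + 1), j ∉ Y → ∑ k ∈ Finset.Iic j, g k ≤ π j

/-- One iteration of the greedy projection procedure (Algorithm 1) as a relation on
states `(Y, f)` of unassigned classes and currently assigned values: choose `y* ∈ Y`
with the highest possibility `π(y*)` such that performing the assignment violates none
of the partial-sum constraints on the classes assigned so far, fix these values, and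
remove `Y' = { y ∈ Y : π(y) ≤ π(y*) }` from `Y`. -/
inductive GreedyStep {K : ℕ} (π phat : Fin (K + 1) → ℝ) :
    Finset (Fin (K + 1)) × (Fin (K + 1) → ℝ) →
    Finset (Fin (K + 1)) × (Fin (K + 1) → ℝ) → Prop where
  | mk (Y : Finset (Fin (K + 1))) (f : Fin (K + 1) → ℝ) (ystar : Fin (K + 1))
      (hmem : ystar ∈ Y)
      (hok : PartialOK π (Assign π phat Y f ystar) (Y.filter fun y => π ystar < π y))
      (hmax : ∀ y ∈ Y, π ystar < π y →
        ¬ PartialOK π (Assign π phat Y f y) (Y.filter fun z => π y < π z)) :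
      GreedyStep π phat (Y, f) (Y.filter (fun y => π ystar < π y), Assign π phat Y f ystar)

section GreedyProjection

open Finset

variable {K : ℕ} {π phat f p : Fin (K + 1) → ℝ} {Y : Finset (Fin (K + 1))} {y : Fin (K + 1)}

/-- The factor by which `Assign` rescales `phat` when `c` is the mass already assigned. -/
noncomputable def assignRatio (π phat : Fin (K + 1) → ℝ) (Y : Finset (Fin (K + 1))) (c : ℝ)
    (y : Fin (K + 1)) : ℝ :=
  (π y - c) / ∑ z ∈ Y.filter (fun z => π z ≤ π y), phat z

theorem sum_filter_le_pos (hpos : ∀ z, 0 < phat z) (hy : y ∈ Y) :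
    0 < ∑ z ∈ Y.filter (fun z => π z ≤ π y), phat z :=
  sum_pos (fun z _ => hpos z) ⟨y, by simp [hy]⟩

theorem assign_of_mem {c : ℝ} (hsum : ∑ z ∈ univ \ Y, f z = c) {z : Fin (K + 1)} (hz : z ∈ Y)
    (hzy : π z ≤ π y) : Assign π phat Y f y z = assignRatio π phat Y c y * phat z := by
  rw [Assign, if_pos ⟨hz, hzy⟩, hsum, assignRatio]
  ring

theorem assign_of_notMem {z : Fin (K + 1)} (hz : z ∉ Y) : Assign π phat Y f y z = f z := by
  simp [Assign, hz]

theorem sum_compl_filter_lt (g : Fin (K + 1) → ℝ) :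
    ∑ z ∈ univ \ Y.filter (fun z => π y < π z), g z =
      ∑ z ∈ univ \ Y, g z + ∑ z ∈ Y.filter (fun z => π z ≤ π y), g z := by
  rw [← sum_union]
  · congr 1
    ext z
    by_cases hz : z ∈ Y <;> simp [hz]
  · rw [disjoint_left]
    intro z hz hz'
    simp_all

theorem compl_filter_lt_eq (hupper : ∀ a ∈ Y, ∀ z ∉ Y, π z < π a) (hy : y ∈ Y) :
    univ \ Y.filter (fun z => π y < π z) = univ.filter (fun z => π z ≤ π y) := by
  ext z
  by_cases hz : z ∈ Y
  · simp [hz]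
  · simp [hz, (hupper y hy z hz).le]

theorem InCredalIic.sum_filter_le (hmono : Monotone π) (hp : InCredalIic π p) :
    ∑ z ∈ univ.filter (fun z => π z ≤ π y), p z ≤ π y := by
  obtain ⟨j, hj, hmax⟩ := exists_max_image (univ.filter (fun z => π z ≤ π y)) id
    ⟨y, by simp⟩
  have hj' : π j ≤ π y := by simpa using hj
  have h : univ.filter (fun z => π z ≤ π y) = Iic j := by
    ext z
    constructor
    · intro hz
      simpa using hmax z hz
    · intro hz
      simpa using (hmono (mem_Iic.1 hz)).trans hj'
  rw [h]
  exact (hp j).trans hj'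

theorem sum_Iic_split (hmono : Monotone π) (hupper : ∀ a ∈ Y, ∀ z ∉ Y, π z < π a)
    {j : Fin (K + 1)} (hj : j ∈ Y) (g : Fin (K + 1) → ℝ) :
    ∑ k ∈ Iic j, g k = ∑ z ∈ univ \ Y, g z + ∑ k ∈ (Iic j).filter (· ∈ Y), g k := by
  rw [← sum_filter_add_sum_filter_not (Iic j) (· ∈ Y), add_comm]
  congr 2
  ext z
  simp only [mem_filter, mem_Iic, mem_sdiff, mem_univ, true_and, and_iff_right_iff_imp]
  exact fun hz => (hmono.reflect_lt (hupper j hj z hz)).le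

theorem partialOK_assign_iff (hmono : Monotone π) (hupper : ∀ a ∈ Y, ∀ z ∉ Y, π z < π a)
    {c : ℝ} (hsum : ∑ z ∈ univ \ Y, f z = c) (hok : PartialOK π f Y) :
    PartialOK π (Assign π phat Y f y) (Y.filter fun z => π y < π z) ↔
      ∀ j ∈ Y, π j ≤ π y →
        c + assignRatio π phat Y c y * ∑ k ∈ (Iic j).filter (· ∈ Y), phat k ≤ π j := by
  have key : ∀ j ∈ Y, π j ≤ π y → ∑ k ∈ Iic j, Assign π phat Y f y k =
      c + assignRatio π phat Y c y * ∑ k ∈ (Iic j).filter (· ∈ Y), phat k := by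
    intro j hj hjy
    rw [sum_Iic_split hmono hupper hj, mul_sum, ← hsum]
    congr 1
    · exact sum_congr rfl fun z hz => assign_of_notMem (by simpa using hz)
    · refine sum_congr rfl fun z hz => ?_
      simp only [mem_filter, mem_Iic] at hz
      rw [hsum]
      exact assign_of_mem hsum hz.2 ((hmono hz.1).trans hjy)
  constructor
  · intro h j hj hjy
    rw [← key j hj hjy]
    exact h j (by simp [hjy])
  · intro h j hj
    by_cases hjY : j ∈ Y
    · have hjy : π j ≤ π y := by simpa [hjY] using hj
      rw [key j hjY hjy]
      exact h j hjY hjy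
    · refine le_of_eq_of_le (sum_congr rfl fun z hz => assign_of_notMem fun hzY => ?_) (hok j hjY)
      exact (hupper z hzY j hjY).not_ge (hmono (mem_Iic.1 hz))

/-- Facts preserved by `GreedyStep`; `c` is the mass assigned so far and `l` the factor used in
the most recent step. -/
structure GreedyInv (π phat : Fin (K + 1) → ℝ) (Y : Finset (Fin (K + 1)))
    (f : Fin (K + 1) → ℝ) (c l : ℝ) : Prop where
  upper : ∀ a ∈ Y, ∀ z ∉ Y, π z < π a
  le_of_mem : ∀ a ∈ Y, c ≤ π a
  le_of_notMem : ∀ a ∉ Y, π a ≤ c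
  le_one : c ≤ 1
  sum_eq : ∑ z ∈ univ \ Y, f z = c
  nonneg : ∀ z ∉ Y, 0 ≤ f z
  partialOK : PartialOK π f Y
  ratio_nonneg : 0 ≤ l
  pos_or : 0 < l ∨ c = 0
  le_ratio : ∀ y ∈ Y, PartialOK π (Assign π phat Y f y) (Y.filter fun z => π y < π z) →
    l ≤ assignRatio π phat Y c y
  eq_zero : ∀ p, IsDist p → InCredalIic π p → ∀ z ∉ Y, f z = 0 → p z = 0
  mass_le : ∀ p, IsDist p → InCredalIic π p → ∑ z ∈ univ \ Y, p z ≤ c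
  variation : ∀ p, IsDist p → InCredalIic π p →
    Real.log l * (∑ z ∈ univ \ Y, p z - c) ≤
      ∑ z ∈ univ \ Y, (p z - f z) * Real.log (f z / phat z)

theorem assignRatio_nonneg (hpos : ∀ z, 0 < phat z) (hy : y ∈ Y) {c : ℝ} (hc : c ≤ π y) :
    0 ≤ assignRatio π phat Y c y :=
  div_nonneg (sub_nonneg.2 hc) (sum_filter_le_pos hpos hy).le

theorem assignRatio_mul_sum (hpos : ∀ z, 0 < phat z) (hy : y ∈ Y) (c : ℝ) :
    assignRatio π phat Y c y * ∑ z ∈ Y.filter (fun z => π z ≤ π y), phat z = π y - c :=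
  div_mul_cancel₀ _ (sum_filter_le_pos hpos hy).ne'

theorem greedyInv_univ (hπ0 : ∀ y, 0 ≤ π y) (hpos : ∀ y, 0 < phat y) (f : Fin (K + 1) → ℝ) :
    GreedyInv π phat univ f 0 0 where
  upper := by simp
  le_of_mem a _ := hπ0 a
  le_of_notMem := by simp
  le_one := zero_le_one
  sum_eq := by simp
  nonneg := by simp
  partialOK := by simp [PartialOK]
  ratio_nonneg := le_rfl
  pos_or := Or.inr rfl
  le_ratio y hy _ := assignRatio_nonneg hpos hy (hπ0 y)
  eq_zero := by simp
  mass_le := by simp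
  variation := by simp

/-- Two consecutive blocks with non-increasing factors could have been assigned at once. -/
theorem assignRatio_lt_of_maximal (hmono : Monotone π) (hpos : ∀ y, 0 < phat y) {c l : ℝ}
    (h : GreedyInv π phat Y f c l) {ystar : Fin (K + 1)} (hmem : ystar ∈ Y)
    (hok : ∀ j ∈ Y, π j ≤ π ystar →
      c + assignRatio π phat Y c ystar * ∑ k ∈ (Iic j).filter (· ∈ Y), phat k ≤ π j)
    (hy : y ∈ Y) (hlt : π ystar < π y)
    (hmax : ¬ PartialOK π (Assign π phat Y f y) (Y.filter fun z => π y < π z))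
    (hok' : ∀ j ∈ Y.filter (fun z => π ystar < π z), π j ≤ π y →
      π ystar + assignRatio π phat (Y.filter fun z => π ystar < π z) (π ystar) y *
        ∑ k ∈ (Iic j).filter (· ∈ Y.filter (fun z => π ystar < π z)), phat k ≤ π j) :
    assignRatio π phat Y c ystar <
      assignRatio π phat (Y.filter fun z => π ystar < π z) (π ystar) y := by
  by_contra! hle
  refine hmax ((partialOK_assign_iff hmono h.upper h.sum_eq h.partialOK).2 ?_)
  have hy' : y ∈ Y.filter (fun z => π ystar < π z) := by simp [hy, hlt]
  have e0 := assignRatio_mul_sum (π := π) hpos hmem c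
  have e1 := assignRatio_mul_sum (π := π) hpos hy' (π ystar)
  have e := assignRatio_mul_sum (π := π) hpos hy c
  have m0 := sum_filter_le_pos (π := π) hpos hmem
  have m1 := sum_filter_le_pos (π := π) hpos hy'
  have hM : ∑ z ∈ Y.filter (fun z => π z ≤ π y), phat z =
      ∑ z ∈ Y.filter (fun z => π z ≤ π ystar), phat z +
      ∑ z ∈ (Y.filter fun z => π ystar < π z).filter (fun z => π z ≤ π y), phat z := by
    rw [← sum_filter_add_sum_filter_not (Y.filter (fun z => π z ≤ π y)) (fun z => π z ≤ π ystar)]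
    congr 2 <;> ext z <;> simp only [mem_filter, not_le] <;> constructor
    · exact fun hz => ⟨hz.1.1, hz.2⟩
    · exact fun hz => ⟨⟨hz.1, hz.2.trans hlt.le⟩, hz.2⟩
    · exact fun hz => ⟨⟨hz.1.1, hz.2⟩, hz.1.2⟩
    · exact fun hz => ⟨⟨hz.1.1, hz.2⟩, hz.1.2⟩
  rw [hM] at e
  set r := assignRatio π phat Y c y
  set r0 := assignRatio π phat Y c ystar
  set r1 := assignRatio π phat (Y.filter fun z => π ystar < π z) (π ystar) y
  set M0 := ∑ z ∈ Y.filter (fun z => π z ≤ π ystar), phat z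
  set M1 := ∑ z ∈ (Y.filter fun z => π ystar < π z).filter (fun z => π z ≤ π y), phat z
  have hr0 : r ≤ r0 := by nlinarith
  have hr1 : r1 ≤ r := by nlinarith
  intro j hj hjy
  by_cases hjs : π j ≤ π ystar
  · have hA : 0 ≤ ∑ k ∈ (Iic j).filter (· ∈ Y), phat k := sum_nonneg fun k _ => (hpos k).le
    have := hok j hj hjs
    nlinarith
  · rw [not_le] at hjs
    have hj' : j ∈ Y.filter (fun z => π ystar < π z) := by simp [hj, hjs]
    have hA : ∑ k ∈ (Iic j).filter (· ∈ Y), phat k =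
        M0 + ∑ k ∈ (Iic j).filter (· ∈ Y.filter (fun z => π ystar < π z)), phat k := by
      rw [← sum_filter_add_sum_filter_not ((Iic j).filter (· ∈ Y)) (fun z => π z ≤ π ystar)]
      congr 2 <;> ext z <;> simp only [mem_filter, not_le, mem_Iic] <;> constructor
      · exact fun hz => ⟨hz.1.2, hz.2⟩
      · exact fun hz => ⟨⟨(hmono.reflect_lt (hz.2.trans_lt hjs)).le, hz.1⟩, hz.2⟩
      · exact fun hz => ⟨hz.1.1, hz.1.2, hz.2⟩
      · exact fun hz => ⟨⟨hz.1, hz.2.1⟩, hz.2.2⟩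
    have hAM : ∑ k ∈ (Iic j).filter (· ∈ Y.filter (fun z => π ystar < π z)), phat k ≤ M1 := by
      refine sum_le_sum_of_subset_of_nonneg (fun z hz => ?_) fun k _ _ => (hpos k).le
      simp only [mem_filter, mem_Iic] at hz ⊢
      exact ⟨hz.2, (hmono hz.1).trans hjy⟩
    have := hok' j hj' hjy
    rw [hA]
    nlinarith

theorem GreedyInv.step (hmono : Monotone π) (hπ1 : ∀ y, π y ≤ 1) (hpos : ∀ y, 0 < phat y)
    {c l : ℝ} (h : GreedyInv π phat Y f c l) {ystar : Fin (K + 1)} (hmem : ystar ∈ Y)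
    (hok : PartialOK π (Assign π phat Y f ystar) (Y.filter fun y => π ystar < π y))
    (hmax : ∀ y ∈ Y, π ystar < π y →
      ¬ PartialOK π (Assign π phat Y f y) (Y.filter fun z => π y < π z)) :
    GreedyInv π phat (Y.filter fun y => π ystar < π y) (Assign π phat Y f ystar) (π ystar)
      (assignRatio π phat Y c ystar) := by
  have hl := h.le_ratio ystar hmem hok
  have hnn := assignRatio_nonneg (π := π) hpos hmem (h.le_of_mem _ hmem)
  have hmul := assignRatio_mul_sum (π := π) hpos hmem c
  have hzero : assignRatio π phat Y c ystar = 0 → π ystar = 0 := by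
    intro h0
    rcases h.pos_or with hp | hc
    · linarith
    · rw [h0, hc] at hmul
      linarith
  have hnot : ∀ z, z ∉ Y.filter (fun y => π ystar < π y) → π z ≤ π ystar := by
    intro z hz
    by_cases hzY : z ∈ Y
    · simpa [hzY] using hz
    · exact (h.upper _ hmem z hzY).le
  have hupper : ∀ a ∈ Y.filter (fun y => π ystar < π y),
      ∀ z ∉ Y.filter (fun y => π ystar < π y), π z < π a :=
    fun a ha z hz => (hnot z hz).trans_lt (mem_filter.1 ha).2
  have hold : ∑ z ∈ univ \ Y, Assign π phat Y f ystar z = c := by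
    rw [← h.sum_eq]
    exact sum_congr rfl fun z hz => assign_of_notMem (by simpa using hz)
  have hnew : ∑ z ∈ Y.filter (fun z => π z ≤ π ystar), Assign π phat Y f ystar z =
      π ystar - c := by
    rw [← hmul, mul_sum]
    refine sum_congr rfl fun z hz => ?_
    rw [mem_filter] at hz
    exact assign_of_mem h.sum_eq hz.1 hz.2
  have hsum : ∑ z ∈ univ \ Y.filter (fun y => π ystar < π y), Assign π phat Y f ystar z =
      π ystar := by
    rw [sum_compl_filter_lt, hold, hnew]
    ring
  have hmass : ∀ p, InCredalIic π p →
      ∑ z ∈ univ \ Y.filter (fun y => π ystar < π y), p z ≤ π ystar := by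
    intro p hp
    rw [compl_filter_lt_eq h.upper hmem]
    exact hp.sum_filter_le hmono
  refine ⟨hupper, fun a ha => (mem_filter.1 ha).2.le, hnot, hπ1 _, hsum, ?_, hok, hnn, ?_, ?_, ?_,
    fun p _ hp => hmass p hp, ?_⟩
  · intro z hz
    by_cases hzY : z ∈ Y
    · rw [assign_of_mem h.sum_eq hzY (hnot z hz)]
      exact mul_nonneg hnn (hpos z).le
    · rw [assign_of_notMem hzY]
      exact h.nonneg z hzY
  · rcases hnn.lt_or_eq with hp | h0
    · exact Or.inl hp
    · exact Or.inr (hzero h0.symm)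
  · intro y hy hyok
    rw [mem_filter] at hy
    exact (assignRatio_lt_of_maximal hmono hpos h hmem
      ((partialOK_assign_iff hmono h.upper h.sum_eq h.partialOK).1 hok) hy.1 hy.2
      (hmax y hy.1 hy.2) ((partialOK_assign_iff hmono hupper hsum hok).1 hyok)).le
  · intro p hpd hp z hz hfz
    by_cases hzY : z ∈ Y
    · rw [assign_of_mem h.sum_eq hzY (hnot z hz)] at hfz
      have h0 := hzero ((mul_eq_zero.1 hfz).resolve_right (hpos z).ne')
      refine le_antisymm ?_ (hpd.1 z)
      calc p z ≤ ∑ z ∈ univ \ Y.filter (fun y => π ystar < π y), p z :=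
            single_le_sum (fun k _ => hpd.1 k) (by simpa using hz)
        _ ≤ 0 := h0 ▸ hmass p hp
    · rw [assign_of_notMem hzY] at hfz
      exact h.eq_zero p hpd hp z hzY hfz
  · intro p hpd hp
    rw [sum_compl_filter_lt, sum_compl_filter_lt]
    have e1 : ∑ z ∈ univ \ Y, (p z - Assign π phat Y f ystar z) *
        Real.log (Assign π phat Y f ystar z / phat z) =
        ∑ z ∈ univ \ Y, (p z - f z) * Real.log (f z / phat z) :=
      sum_congr rfl fun z hz => by rw [assign_of_notMem (by simpa using hz)]
    have e2 : ∑ z ∈ Y.filter (fun z => π z ≤ π ystar), (p z - Assign π phat Y f ystar z) *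
        Real.log (Assign π phat Y f ystar z / phat z) =
        (∑ z ∈ Y.filter (fun z => π z ≤ π ystar), p z - (π ystar - c)) *
          Real.log (assignRatio π phat Y c ystar) := by
      rw [← hnew, ← sum_sub_distrib, sum_mul]
      refine sum_congr rfl fun z hz => ?_
      rw [mem_filter] at hz
      congr 2
      rw [assign_of_mem h.sum_eq hz.1 hz.2, mul_div_cancel_right₀ _ (hpos z).ne']
    rw [e1, e2]
    have hv := h.variation p hpd hp
    have hm := h.mass_le p hpd hp
    have hm0 : 0 ≤ ∑ z ∈ univ \ Y, p z := sum_nonneg fun z _ => hpd.1 z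
    rcases h.pos_or with hlpos | hc
    · have := Real.log_le_log hlpos hl
      nlinarith
    · have hP : ∑ z ∈ univ \ Y, p z = c := by linarith
      rw [hP] at hv ⊢
      linarith

theorem GreedyInv.of_reflTransGen (hmono : Monotone π) (hπ0 : ∀ y, 0 ≤ π y)
    (hπ1 : ∀ y, π y ≤ 1) (hpos : ∀ y, 0 < phat y)
    {s : Finset (Fin (K + 1)) × (Fin (K + 1) → ℝ)}
    (h : Relation.ReflTransGen (GreedyStep π phat) (univ, f) s) :
    ∃ c l, GreedyInv π phat s.1 s.2 c l := by
  induction h with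
  | refl => exact ⟨0, 0, greedyInv_univ hπ0 hpos f⟩
  | tail _ hstep ih =>
    obtain ⟨c, l, hinv⟩ := ih
    cases hstep with
    | mk Y f ystar hmem hok hmax => exact ⟨_, _, hinv.step hmono hπ1 hpos hmem hok hmax⟩

/-- First-order sufficient condition for `KL r q ≤ KL p q`. -/
theorem KL_le_KL_of_variation {p q r : Fin (K + 1) → ℝ} (hq : ∀ y, 0 < q y)
    (hp : ∀ y, 0 ≤ p y) (hr : ∀ y, 0 ≤ r y) (hsum : ∑ y, p y = ∑ y, r y)
    (hzero : ∀ y, r y = 0 → p y = 0)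
    (hvar : 0 ≤ ∑ y, (p y - r y) * Real.log (r y / q y)) : KL r q ≤ KL p q := by
  have key : ∀ y, r y * Real.log (r y / q y) + (p y - r y) * Real.log (r y / q y) + (p y - r y) ≤
      p y * Real.log (p y / q y) := by
    intro y
    rcases (hp y).eq_or_lt with h0 | hppos
    · have := hr y
      rw [← h0]
      linarith
    · have hrpos : 0 < r y := (hr y).lt_of_ne fun h => hppos.ne' (hzero y h.symm)
      have h1 := Real.log_le_sub_one_of_pos (div_pos hrpos hppos)
      rw [Real.log_div hrpos.ne' hppos.ne'] at h1
      rw [Real.log_div hrpos.ne' (hq y).ne', Real.log_div hppos.ne' (hq y).ne']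
      have h2 := mul_le_mul_of_nonneg_left h1 hppos.le
      have h3 : p y * (r y / p y - 1) = r y - p y := by field_simp
      rw [h3] at h2
      linarith
  have h := sum_le_sum fun y (_ : y ∈ univ) => key y
  rw [sum_add_distrib, sum_add_distrib, sum_sub_distrib, hsum] at h
  unfold KL
  linarith

end GreedyProjection

/-- **Optimality of the greedy projection; Theorem 1.**  Let `p^r` be the
output of the greedy procedure: `p^r = p̂` if `p̂ ∈ Q_π`, and otherwise `p^r` is the
function obtained after iterating greedy assignment steps from the initial state (all
classes unassigned) until no class remains unassigned.  Then `p^r ∈ Q_π` and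
`D_KL(p^r‖p̂) = min_{p ∈ Q_π} D_KL(p‖p̂)`, i.e. the value returned by the procedure is
the optimistic superset loss `L*(Q_π, p̂)`. -/
theorem greedy_projection_optimal {K : ℕ} (π phat : Fin (K + 1) → ℝ)
    (hmono : Monotone π) (hπ0 : ∀ y, 0 ≤ π y) (hnorm : π (Fin.last K) = 1)
    (hphat : IsDist phat) (hpos : ∀ y, 0 < phat y)
    (pr : Fin (K + 1) → ℝ)
    (hpr : (InCredalIic π phat ∧ pr = phat) ∨
      (¬ InCredalIic π phat ∧ ∃ f0 : Fin (K + 1) → ℝ,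
        Relation.ReflTransGen (GreedyStep π phat) (Finset.univ, f0) (∅, pr))) :
    (IsDist pr ∧ InCredalIic π pr) ∧
      ∀ p : Fin (K + 1) → ℝ, IsDist p → InCredalIic π p →
        KL pr phat ≤ KL p phat := by
  rcases hpr with ⟨hQ, rfl⟩ | ⟨-, f0, hgen⟩
  · refine ⟨⟨hphat, hQ⟩, fun p hp _ => KL_le_KL_of_variation hpos hp.1 hphat.1
      (hp.2.2.trans hphat.2.2.symm) (fun y hy => absurd hy (hpos y).ne') ?_⟩
    simp [div_self (hpos _).ne']
  · have hπ1 : ∀ y, π y ≤ 1 := fun y => hnorm ▸ hmono (Fin.le_last y)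
    obtain ⟨c, l, h⟩ := GreedyInv.of_reflTransGen hmono hπ0 hπ1 hpos hgen
    have hc : c = 1 := le_antisymm h.le_one (hnorm ▸ h.le_of_notMem (Fin.last K) (by simp))
    have hsum : ∑ y, pr y = 1 := by simpa [hc] using h.sum_eq
    have hnn : ∀ y, 0 ≤ pr y := fun y => h.nonneg y (by simp)
    refine ⟨⟨⟨hnn, fun y => ?_, hsum⟩, fun i => h.partialOK i (by simp)⟩, fun p hp hpQ => ?_⟩
    · rw [← hsum]
      exact Finset.single_le_sum (fun k _ => hnn k) (Finset.mem_univ y)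
    · refine KL_le_KL_of_variation hpos hp.1 hnn (hp.2.2.trans hsum.symm)
        (fun y hy => h.eq_zero p hp hpQ y (by simp) hy) ?_
      simpa [hc, hp.2.2] using h.variation p hp hpQ
end
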